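/- arXiv:0908.2398 — 4 statements merged into one kernel-verified Lean document; each statement's English description precedes it below -/
import Mathlib

section
/- Let q be a power of an odd prime, F_q a finite field with q elements, n ≥ 1, and let J ∈ M_{2n}(F_q) be an invertible symmetric matrix that is split, i.e. PᵀJP = [[0, I_n],[I_n, 0]] for some invertible P. Let G = GO(J) and K = {g ∈ G : g² = I and μ(g) = −1}. Then K is nonempty, any two elements of K are conjugate in G, and for any g ∈ K the centralizer of g in G is isomorphic as a group to F_q^× × GL(n, F_q); in particular it has order (q−1)·|GL(n, F_q)|. -/
open Matrix CategoryTheory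
open scoped Classical

noncomputable section

/-- The Frobenius–Schur indicator of a complex-valued function on a finite group. -/
def fsIndicator (G : Type*) [Group G] [Fintype G] (χ : G → ℂ) : ℂ :=
  (Fintype.card G : ℂ)⁻¹ * ∑ g : G, χ (g * g)

/-- The twisted Frobenius–Schur indicator of a complex-valued function on a finite group,
with respect to a map `σ`. -/
def twistedFSIndicator (G : Type*) [Group G] [Fintype G] (σ : G → G) (χ : G → ℂ) : ℂ :=
  (Fintype.card G : ℂ)⁻¹ * ∑ g : G, χ (g * σ g)

/-- A complex-valued function is real-valued if all its values are real. -/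
def IsRealValued {G : Type*} (χ : G → ℂ) : Prop := ∀ g : G, ∃ r : ℝ, χ g = (r : ℂ)

/-- The Gaussian binomial coefficient `binom(m,k)_q` as a real number. -/
def gbinom (m k : ℕ) (q : ℝ) : ℝ := ∏ i ∈ Finset.Icc 1 k, (q ^ (m - k + i) - 1) / (q ^ i - 1)

section Groups

variable {N F : Type*} [Fintype N] [DecidableEq N] [Field F]

theorem sim_one (J : Matrix N N F) :
    ((1 : GL N F) : Matrix N N F)ᵀ * J * ((1 : GL N F) : Matrix N N F) = ((1 : Fˣ) : F) • J := by
  simp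

theorem sim_mul {J : Matrix N N F} (a b : GL N F) (c d : Fˣ)
    (hc : (a : Matrix N N F)ᵀ * J * (a : Matrix N N F) = (c : F) • J)
    (hd : (b : Matrix N N F)ᵀ * J * (b : Matrix N N F) = (d : F) • J) :
    ((a * b : GL N F) : Matrix N N F)ᵀ * J * ((a * b : GL N F) : Matrix N N F)
      = ((c * d : Fˣ) : F) • J := by
  calc ((a * b : GL N F) : Matrix N N F)ᵀ * J * ((a * b : GL N F) : Matrix N N F)
      = (b : Matrix N N F)ᵀ * ((a : Matrix N N F)ᵀ * J * (a : Matrix N N F)) *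
          (b : Matrix N N F) := by
        rw [show ((a * b : GL N F) : Matrix N N F) = (a : Matrix N N F) * b from rfl,
          transpose_mul]
        simp only [Matrix.mul_assoc]
    _ = (b : Matrix N N F)ᵀ * ((c : F) • J) * (b : Matrix N N F) := by rw [hc]
    _ = (c : F) • ((b : Matrix N N F)ᵀ * J * (b : Matrix N N F)) := by
        rw [Matrix.mul_smul, Matrix.smul_mul]
    _ = (c : F) • ((d : F) • J) := by rw [hd]
    _ = ((c * d : Fˣ) : F) • J := by rw [smul_smul, Units.val_mul]

theorem sim_inv {J : Matrix N N F} (a : GL N F) (c : Fˣ)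
    (hc : (a : Matrix N N F)ᵀ * J * (a : Matrix N N F) = (c : F) • J) :
    ((a⁻¹ : GL N F) : Matrix N N F)ᵀ * J * ((a⁻¹ : GL N F) : Matrix N N F)
      = ((c⁻¹ : Fˣ) : F) • J := by
  have ht : ((a⁻¹ : GL N F) : Matrix N N F)ᵀ * (a : Matrix N N F)ᵀ = 1 := by
    rw [← transpose_mul, a.mul_inv, transpose_one]
  have key : ((a⁻¹ : GL N F) : Matrix N N F)ᵀ * ((a : Matrix N N F)ᵀ * J * (a : Matrix N N F)) *
      ((a⁻¹ : GL N F) : Matrix N N F) = J := by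
    calc ((a⁻¹ : GL N F) : Matrix N N F)ᵀ * ((a : Matrix N N F)ᵀ * J * (a : Matrix N N F)) *
        ((a⁻¹ : GL N F) : Matrix N N F)
        = (((a⁻¹ : GL N F) : Matrix N N F)ᵀ * (a : Matrix N N F)ᵀ) * J *
          ((a : Matrix N N F) * ((a⁻¹ : GL N F) : Matrix N N F)) := by
          simp only [Matrix.mul_assoc]
      _ = J := by rw [ht, a.mul_inv, Matrix.one_mul, Matrix.mul_one]
  have key2 : ((a⁻¹ : GL N F) : Matrix N N F)ᵀ * ((c : F) • J) * ((a⁻¹ : GL N F) : Matrix N N F)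
      = (c : F) • (((a⁻¹ : GL N F) : Matrix N N F)ᵀ * J * ((a⁻¹ : GL N F) : Matrix N N F)) := by
    rw [Matrix.mul_smul, Matrix.smul_mul]
  have h3 : (c : F) • (((a⁻¹ : GL N F) : Matrix N N F)ᵀ * J *
      ((a⁻¹ : GL N F) : Matrix N N F)) = J := by rw [← key2, ← hc, key]
  calc ((a⁻¹ : GL N F) : Matrix N N F)ᵀ * J * ((a⁻¹ : GL N F) : Matrix N N F)
      = ((c⁻¹ : Fˣ) : F) • ((c : F) • (((a⁻¹ : GL N F) : Matrix N N F)ᵀ * J *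
          ((a⁻¹ : GL N F) : Matrix N N F))) := by
        rw [smul_smul, ← Units.val_mul, inv_mul_cancel, Units.val_one, one_smul]
    _ = ((c⁻¹ : Fˣ) : F) • J := by rw [h3]

/-- The similitude group of the bilinear form given by the matrix `J`:  all invertible
matrices `g` with `gᵀ * J * g = c • J` for some nonzero scalar `c` (the similitude of `g`). -/
def similitudeGroup (J : Matrix N N F) : Subgroup (GL N F) where
  carrier := {g | ∃ c : Fˣ, (g : Matrix N N F)ᵀ * J * (g : Matrix N N F) = (c : F) • J}
  one_mem' := ⟨1, sim_one J⟩
  mul_mem' := by rintro a b ⟨c, hc⟩ ⟨d, hd⟩; exact ⟨c * d, sim_mul a b c d hc hd⟩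
  inv_mem' := by rintro a ⟨c, hc⟩; exact ⟨c⁻¹, sim_inv a c hc⟩

/-- The isometry group of the bilinear form given by the matrix `J`:  all invertible
matrices `g` with `gᵀ * J * g = J`. -/
def fixGroup (J : Matrix N N F) : Subgroup (GL N F) where
  carrier := {g | (g : Matrix N N F)ᵀ * J * (g : Matrix N N F) = J}
  one_mem' := by simp
  mul_mem' := by
    intro a b ha hb
    have := sim_mul (J := J) a b 1 1 (by simpa using ha) (by simpa using hb)
    simpa using this
  inv_mem' := by
    intro a ha
    have := sim_inv (J := J) a 1 (by simpa using ha)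
    simpa using this

/-- The group of isometries of determinant one of the bilinear form given by the matrix `J`. -/
def specialFixGroup (J : Matrix N N F) : Subgroup (GL N F) where
  carrier := {g | (g : Matrix N N F)ᵀ * J * (g : Matrix N N F) = J ∧
    ((g : Matrix N N F)).det = 1}
  one_mem' := ⟨by simp, by simp⟩
  mul_mem' := by
    rintro a b ⟨ha1, ha2⟩ ⟨hb1, hb2⟩
    refine ⟨(fixGroup J).mul_mem ha1 hb1, ?_⟩
    rw [show ((a * b : GL N F) : Matrix N N F) = (a : Matrix N N F) * b from rfl,
      Matrix.det_mul, ha2, hb2, one_mul]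
  inv_mem' := by
    rintro a ⟨ha1, ha2⟩
    refine ⟨(fixGroup J).inv_mem ha1, ?_⟩
    have h := congrArg Matrix.det a.mul_inv
    rw [Matrix.det_mul, ha2, one_mul, Matrix.det_one] at h
    exact h

/-- The connected component of the similitude group of the symmetric bilinear form on a
`2 * m`-dimensional space given by the matrix `J`:  all similitudes `g`, with similitude
character `μ`, such that `det g = μ(g) ^ m`. -/
def connSimilitudeGroup (J : Matrix N N F) (m : ℕ) : Subgroup (GL N F) where
  carrier := {g | ∃ c : Fˣ, (g : Matrix N N F)ᵀ * J * (g : Matrix N N F) = (c : F) • J ∧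
    ((g : Matrix N N F)).det = (c : F) ^ m}
  one_mem' := ⟨1, sim_one J, by simp⟩
  mul_mem' := by
    rintro a b ⟨c, hc1, hc2⟩ ⟨d, hd1, hd2⟩
    refine ⟨c * d, sim_mul a b c d hc1 hd1, ?_⟩
    rw [show ((a * b : GL N F) : Matrix N N F) = (a : Matrix N N F) * b from rfl,
      Matrix.det_mul, hc2, hd2, Units.val_mul, mul_pow]
  inv_mem' := by
    rintro a ⟨c, hc1, hc2⟩
    refine ⟨c⁻¹, sim_inv a c hc1, ?_⟩
    have h := congrArg Matrix.det a.mul_inv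
    rw [Matrix.det_mul, hc2, Matrix.det_one] at h
    have hc : ((c : F) ^ m)⁻¹ = ((c⁻¹ : Fˣ) : F) ^ m := by
      rw [← inv_pow]
      norm_cast
    rw [← hc]
    exact (inv_eq_of_mul_eq_one_right h).symm

theorem neg_one_mem_similitudeGroup (J : Matrix N N F) : (-1 : GL N F) ∈ similitudeGroup J := by
  refine ⟨1, ?_⟩
  have h : ((-1 : GL N F) : Matrix N N F) = -1 := by simp
  rw [h]
  simp

/-- The standard symplectic form matrix `[[0, I], [-I, 0]]`. -/
def Jsp (n : ℕ) (F : Type*) [Field F] : Matrix (Fin n ⊕ Fin n) (Fin n ⊕ Fin n) F :=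
  Matrix.fromBlocks 0 1 (-1) 0

/-- The standard split symmetric form matrix `[[0, I], [I, 0]]`. -/
def Jsplit (n : ℕ) (F : Type*) [Field F] : Matrix (Fin n ⊕ Fin n) (Fin n ⊕ Fin n) F :=
  Matrix.fromBlocks 0 1 1 0

/-- A symmetric matrix `J` of size `2n` is split if it is congruent to `[[0, I], [I, 0]]`. -/
def IsSplit {n : ℕ} (J : Matrix (Fin n ⊕ Fin n) (Fin n ⊕ Fin n) F) : Prop :=
  ∃ P : GL (Fin n ⊕ Fin n) F,
    (P : Matrix (Fin n ⊕ Fin n) (Fin n ⊕ Fin n) F)ᵀ * J * P = Jsplit n F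

/-- The symplectic similitude group `GSp(2n, F)`. -/
def GSp (n : ℕ) (F : Type*) [Field F] : Subgroup (GL (Fin n ⊕ Fin n) F) :=
  similitudeGroup (Jsp n F)

/-- The symplectic group `Sp(2n, F)`. -/
def Sp (n : ℕ) (F : Type*) [Field F] : Subgroup (GL (Fin n ⊕ Fin n) F) :=
  fixGroup (Jsp n F)


/-- The underlying matrix of an element of a matrix subgroup. -/
def matOf {S : Subgroup (GL N F)} (g : ↥S) : Matrix N N F := ((g : GL N F) : Matrix N N F)

end Groups

noncomputable instance subgroupFintype {G : Type*} [Group G] [Finite G] (S : Subgroup G) :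
    Fintype S := Fintype.ofFinite _

section SplitSimilitudes

variable {N F : Type*} [Fintype N] [DecidableEq N] [Field F]

theorem congr_inv {J J' : Matrix N N F} (P : GL N F)
    (h : (P : Matrix N N F)ᵀ * J * (P : Matrix N N F) = J') :
    ((P⁻¹ : GL N F) : Matrix N N F)ᵀ * J' * ((P⁻¹ : GL N F) : Matrix N N F) = J := by
  have ht : ((P⁻¹ : GL N F) : Matrix N N F)ᵀ * (P : Matrix N N F)ᵀ = 1 := by
    rw [← transpose_mul, P.mul_inv, transpose_one]
  calc _ = (((P⁻¹ : GL N F) : Matrix N N F)ᵀ * (P : Matrix N N F)ᵀ) * J *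
        ((P : Matrix N N F) * ((P⁻¹ : GL N F) : Matrix N N F)) := by
        rw [← h]; simp only [Matrix.mul_assoc]
    _ = J := by rw [ht, P.mul_inv, Matrix.one_mul, Matrix.mul_one]

theorem sim_conj {J J' : Matrix N N F} (P M : GL N F) (c : F)
    (h : (P : Matrix N N F)ᵀ * J * (P : Matrix N N F) = J')
    (hM : (M : Matrix N N F)ᵀ * J' * (M : Matrix N N F) = c • J') :
    ((P * M * P⁻¹ : GL N F) : Matrix N N F)ᵀ * J * ((P * M * P⁻¹ : GL N F) : Matrix N N F)
      = c • J := by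
  calc _ = ((P⁻¹ : GL N F) : Matrix N N F)ᵀ * ((M : Matrix N N F)ᵀ *
        ((P : Matrix N N F)ᵀ * J * (P : Matrix N N F)) * (M : Matrix N N F)) *
        ((P⁻¹ : GL N F) : Matrix N N F) := by
        rw [Units.val_mul, Units.val_mul, transpose_mul, transpose_mul]
        simp only [Matrix.mul_assoc]
    _ = c • J := by rw [h, hM, Matrix.mul_smul, Matrix.smul_mul, congr_inv P h]

/-- The block-diagonal similitude `diag(A, c • A⁻ᵀ)` of the standard split form, which has
similitude factor `c`. -/
def splitLevi (n : ℕ) (F : Type*) [Field F] : Fˣ × GL (Fin n) F →* GL (Fin n ⊕ Fin n) F :=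
  MonoidHom.toHomUnits
    { toFun := fun x => fromBlocks (x.2 : Matrix (Fin n) (Fin n) F) 0 0
        ((x.1 : F) • ((x.2⁻¹ : GL (Fin n) F) : Matrix (Fin n) (Fin n) F)ᵀ)
      map_one' := by simp
      map_mul' := fun x y => by
        simp [fromBlocks_multiply, -coe_units_inv, mul_comm, smul_smul] }

variable {n : ℕ}

theorem coe_splitLevi (x : Fˣ × GL (Fin n) F) :
    (splitLevi n F x : Matrix (Fin n ⊕ Fin n) (Fin n ⊕ Fin n) F) =
      fromBlocks (x.2 : Matrix (Fin n) (Fin n) F) 0 0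
        ((x.1 : F) • ((x.2⁻¹ : GL (Fin n) F) : Matrix (Fin n) (Fin n) F)ᵀ) :=
  rfl

theorem coe_splitLevi_neg_one :
    (splitLevi n F (-1, 1) : Matrix (Fin n ⊕ Fin n) (Fin n ⊕ Fin n) F) =
      fromBlocks 1 0 0 (-1) := by
  simp [coe_splitLevi]

theorem splitLevi_sim (x : Fˣ × GL (Fin n) F) :
    (splitLevi n F x : Matrix (Fin n ⊕ Fin n) (Fin n ⊕ Fin n) F)ᵀ * Jsplit n F *
      (splitLevi n F x : Matrix (Fin n ⊕ Fin n) (Fin n ⊕ Fin n) F) = (x.1 : F) • Jsplit n F := by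
  have h1 : (x.2 : Matrix (Fin n) (Fin n) F)ᵀ *
      ((x.2⁻¹ : GL (Fin n) F) : Matrix (Fin n) (Fin n) F)ᵀ = 1 := by
    rw [← transpose_mul, x.2.inv_mul, transpose_one]
  have h2 : ((x.2⁻¹ : GL (Fin n) F) : Matrix (Fin n) (Fin n) F) * x.2 = 1 := x.2.inv_mul
  simp only [coe_splitLevi, Jsplit, fromBlocks_transpose, fromBlocks_multiply, fromBlocks_smul]
  simp [-coe_units_inv, h1, h2]

theorem splitLevi_injective (hn : 1 ≤ n) : Function.Injective (splitLevi n F) := by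
  intro x y hxy
  have h := congrArg (Units.val) hxy
  rw [coe_splitLevi, coe_splitLevi, fromBlocks_inj] at h
  obtain ⟨h2, -, -, h1⟩ := h
  have h2' : x.2 = y.2 := Units.ext h2
  refine Prod.ext (Units.ext ?_) h2'
  have h3 := congrArg (fun M => (x.2 : Matrix (Fin n) (Fin n) F)ᵀ * M) h1
  have h4 : (x.2 : Matrix (Fin n) (Fin n) F)ᵀ *
      ((x.2⁻¹ : GL (Fin n) F) : Matrix (Fin n) (Fin n) F)ᵀ = 1 := by
    rw [← transpose_mul, x.2.inv_mul, transpose_one]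
  simp only [← h2', Matrix.mul_smul, h4] at h3
  simpa using congrFun (congrFun h3 ⟨0, hn⟩) ⟨0, hn⟩

theorem eq_zero_of_eq_neg_self {V : Type*} [AddCommGroup V] [Module F V] [NeZero (2 : F)]
    (v : V) (hv : v = -v) : v = 0 := by
  have h : (2 : F) • v = 0 := by rw [two_smul]; nth_rewrite 2 [hv]; simp
  exact (smul_eq_zero.mp h).resolve_left (NeZero.ne _)

theorem exists_splitLevi_eq [NeZero (2 : F)] (M : GL (Fin n ⊕ Fin n) F) (c : Fˣ)
    (hM : (M : Matrix (Fin n ⊕ Fin n) (Fin n ⊕ Fin n) F)ᵀ * Jsplit n F * M =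
      (c : F) • Jsplit n F)
    (hcomm : Commute M (splitLevi n F (-1, 1))) : ∃ x, splitLevi n F x = M := by
  have hc := congrArg Units.val hcomm.eq
  rw [Units.val_mul, Units.val_mul, coe_splitLevi_neg_one] at hc
  obtain ⟨A, B, C, D, hABCD⟩ : ∃ A B C D, (M : Matrix (Fin n ⊕ Fin n) (Fin n ⊕ Fin n) F) =
      fromBlocks A B C D := ⟨_, _, _, _, (fromBlocks_toBlocks _).symm⟩
  rw [hABCD] at hc hM
  simp only [fromBlocks_multiply, fromBlocks_inj] at hc
  have hB : B = 0 := eq_zero_of_eq_neg_self (F := F) B (by simpa using hc.2.1.symm)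
  have hC : C = 0 := eq_zero_of_eq_neg_self (F := F) C (by simpa using hc.2.2.1)
  subst hB hC
  simp only [Jsplit, fromBlocks_transpose, fromBlocks_multiply, fromBlocks_smul,
    fromBlocks_inj] at hM
  have hAD : Aᵀ * D = (c : F) • 1 := by simpa using hM.2.1
  have hA : Aᵀ * ((c⁻¹ : Fˣ) • D) = 1 := by
    rw [Matrix.mul_smul, hAD, Units.smul_def, smul_smul]; simp
  have hA' : ((c⁻¹ : Fˣ) • D)ᵀ * A = 1 := by
    rw [← transpose_inj, transpose_mul, transpose_transpose, hA, transpose_one]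
  let A' : GL (Fin n) F := ⟨A, ((c⁻¹ : Fˣ) • D)ᵀ, mul_eq_one_comm.mp hA', hA'⟩
  refine ⟨(c, A'), Units.ext ?_⟩
  rw [coe_splitLevi, hABCD]
  congr 1
  change (c : F) • (((c⁻¹ : Fˣ) • D)ᵀ)ᵀ = D
  rw [transpose_transpose, Units.smul_def, smul_smul]
  simp

theorem isCompl_ker_sub_add_one {V : Type*} [AddCommGroup V] [Module F V] [NeZero (2 : F)]
    (f : V →ₗ[F] V) (hf : f * f = 1) :
    IsCompl (LinearMap.ker (f - 1)) (LinearMap.ker (f + 1)) := by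
  have h2 : (2 : F) ≠ 0 := NeZero.ne _
  have hff : ∀ v, f (f v) = v := fun v => by
    simpa using LinearMap.congr_fun hf v
  constructor
  · rw [Submodule.disjoint_def]
    intro v h1 h3
    have h1 : f v = v := by simpa [sub_eq_zero] using h1
    have h3 : f v + v = 0 := by simpa using h3
    rw [h1, ← two_smul F] at h3
    exact (smul_eq_zero.mp h3).resolve_left h2
  · rw [codisjoint_iff, Submodule.eq_top_iff']
    intro v
    refine Submodule.mem_sup.mpr ⟨(2 : F)⁻¹ • (v + f v), ?_, (2 : F)⁻¹ • (v - f v), ?_, ?_⟩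
    · simp [hff, add_comm]
    · simp [hff]
    · rw [← smul_add, add_add_sub_cancel, ← two_smul F, smul_smul, inv_mul_cancel₀ h2, one_smul]

theorem finrank_ker_sub_one_eq {J g : Matrix N N F} (hJ : IsUnit J) (hg : g * g = 1)
    (hgJ : gᵀ * J * g = (-1 : F) • J) :
    Module.finrank F (LinearMap.ker (toLin' g - 1)) =
      Module.finrank F (LinearMap.ker (toLin' g + 1)) := by
  have hgJ' : gᵀ * J = -(J * g) := by
    calc gᵀ * J = gᵀ * J * g * g := by rw [Matrix.mul_assoc, hg, Matrix.mul_one]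
      _ = -(J * g) := by rw [hgJ]; simp
  have hrank : (g + 1).rank = (g - 1).rank := by
    have hJd : IsUnit J.det := (isUnit_iff_isUnit_det J).mp hJ
    have hnJd : IsUnit (-J).det := (isUnit_iff_isUnit_det _).mp hJ.neg
    rw [← rank_transpose (g + 1), ← rank_mul_eq_left_of_isUnit_det J (g + 1)ᵀ hJd,
      ← rank_mul_eq_right_of_isUnit_det (-J) (g - 1) hnJd]
    congr 1
    rw [transpose_add, Matrix.add_mul, hgJ', transpose_one, Matrix.one_mul, Matrix.mul_sub,
      Matrix.mul_one, Matrix.neg_mul, sub_neg_eq_add]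
  have hs : toLin' g - 1 = toLin' (g - 1) := by simp [toLin'_one, Module.End.one_eq_id]
  have ha : toLin' g + 1 = toLin' (g + 1) := by simp [toLin'_one, Module.End.one_eq_id]
  have h1 := (toLin' (g - 1)).finrank_range_add_finrank_ker
  have h2 := (toLin' (g + 1)).finrank_range_add_finrank_ker
  have hr : Module.finrank F (LinearMap.range (toLin' (g + 1))) =
      Module.finrank F (LinearMap.range (toLin' (g - 1))) := hrank
  rw [hr] at h2
  rw [hs, ha]
  exact Nat.add_left_cancel (h1.trans h2.symm)

theorem exists_conj_splitLevi_neg_one [NeZero (2 : F)] (g : GL (Fin n ⊕ Fin n) F)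
    {J : Matrix (Fin n ⊕ Fin n) (Fin n ⊕ Fin n) F} (hJ : IsUnit J) (hg : g * g = 1)
    (hgJ : (g : Matrix (Fin n ⊕ Fin n) (Fin n ⊕ Fin n) F)ᵀ * J * g = (-1 : F) • J) :
    ∃ Q : GL (Fin n ⊕ Fin n) F, g * Q = Q * splitLevi n F (-1, 1) := by
  have hg' : (g : Matrix (Fin n ⊕ Fin n) (Fin n ⊕ Fin n) F) * g = 1 := congrArg Units.val hg
  set f := toLin' (g : Matrix (Fin n ⊕ Fin n) (Fin n ⊕ Fin n) F) with hf
  have hcompl := isCompl_ker_sub_add_one f (by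
    rw [Module.End.mul_eq_comp, hf, ← toLin'_mul, hg', toLin'_one, Module.End.one_eq_id])
  have heq := finrank_ker_sub_one_eq hJ hg' hgJ
  have hsum := Submodule.finrank_add_eq_of_isCompl hcompl
  rw [← hf] at heq
  simp only [Module.finrank_fintype_fun_eq_card, Fintype.card_sum, Fintype.card_fin] at hsum
  let b := ((Module.finBasisOfFinrankEq F (LinearMap.ker (f - 1)) (n := n) (by omega)).prod
    (Module.finBasisOfFinrankEq F (LinearMap.ker (f + 1)) (n := n) (by omega))).map
    (Submodule.prodEquivOfIsCompl _ _ hcompl)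
  have hb1 : ∀ j, f (b (Sum.inl j)) = b (Sum.inl j) := fun j => by
    have : b (Sum.inl j) ∈ LinearMap.ker (f - 1) := by simp [b, -LinearMap.mem_ker]
    simpa [sub_eq_zero] using this
  have hb2 : ∀ j, f (b (Sum.inr j)) = - b (Sum.inr j) := fun j => by
    have : b (Sum.inr j) ∈ LinearMap.ker (f + 1) := by simp [b, -LinearMap.mem_ker]
    simpa [add_eq_zero_iff_eq_neg] using this
  let Q : Matrix (Fin n ⊕ Fin n) (Fin n ⊕ Fin n) F := (Pi.basisFun F _).toMatrix b
  let Q' : GL (Fin n ⊕ Fin n) F := ⟨Q, b.toMatrix (Pi.basisFun F _),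
    Module.Basis.toMatrix_mul_toMatrix_flip _ _, Module.Basis.toMatrix_mul_toMatrix_flip _ _⟩
  refine ⟨Q', Units.ext ?_⟩
  rw [Units.val_mul, Units.val_mul, coe_splitLevi_neg_one]
  have hdiag : (fromBlocks 1 0 0 (-1) : Matrix (Fin n ⊕ Fin n) (Fin n ⊕ Fin n) F) =
      diagonal (Sum.elim 1 (-1)) := by
    ext (i | i) (j | j) <;>
      simp [diagonal_apply, Matrix.one_apply]
    split_ifs <;> simp
  rw [hdiag]
  ext i j
  rw [mul_diagonal]
  have hQ : ∀ i j, (Q' : Matrix (Fin n ⊕ Fin n) (Fin n ⊕ Fin n) F) i j = b j i :=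
    fun i j => by simp [Q', Q, Module.Basis.toMatrix_apply]
  have hmul : ((g : Matrix (Fin n ⊕ Fin n) (Fin n ⊕ Fin n) F) * Q') i j = f (b j) i := by
    simp [Matrix.mul_apply, hf, toLin'_apply, mulVec, dotProduct, hQ]
  rw [hmul, hQ]
  rcases j with j | j
  · simp [hb1]
  · simp [hb2]

theorem exists_isometry_conj_splitLevi_neg_one [NeZero (2 : F)] (g : GL (Fin n ⊕ Fin n) F)
    {J : Matrix (Fin n ⊕ Fin n) (Fin n ⊕ Fin n) F} (hJ : IsUnit J) (hJsymm : Jᵀ = J)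
    (hg : g * g = 1)
    (hgJ : (g : Matrix (Fin n ⊕ Fin n) (Fin n ⊕ Fin n) F)ᵀ * J * g = (-1 : F) • J) :
    ∃ P : GL (Fin n ⊕ Fin n) F,
      (P : Matrix (Fin n ⊕ Fin n) (Fin n ⊕ Fin n) F)ᵀ * J * P = Jsplit n F ∧
      g = P * splitLevi n F (-1, 1) * P⁻¹ := by
  obtain ⟨Q, hQ⟩ := exists_conj_splitLevi_neg_one g hJ hg hgJ
  set S := (Q : Matrix (Fin n ⊕ Fin n) (Fin n ⊕ Fin n) F)ᵀ * J * Q with hS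
  have hSsim := sim_conj Q⁻¹ g (-1) (congr_inv Q hS.symm) hgJ
  have hD : Q⁻¹ * g * Q⁻¹⁻¹ = splitLevi n F (-1, 1) := by
    rw [inv_inv, mul_assoc, hQ, inv_mul_cancel_left]
  rw [hD, coe_splitLevi_neg_one] at hSsim
  have hSt : Sᵀ = S := by simp [hS, hJsymm, Matrix.mul_assoc]
  have hSu : IsUnit S := by
    rw [hS]
    exact (((isUnit_transpose _).mpr Q.isUnit).mul hJ).mul Q.isUnit
  obtain ⟨A, B, C, D, hABCD⟩ : ∃ A B C D, S = fromBlocks A B C D :=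
    ⟨_, _, _, _, (fromBlocks_toBlocks _).symm⟩
  rw [hABCD] at hSsim hSt hSu
  simp only [fromBlocks_transpose, fromBlocks_multiply, fromBlocks_smul, fromBlocks_inj]
    at hSsim hSt
  have hA : A = 0 := eq_zero_of_eq_neg_self (F := F) A (by simpa using hSsim.1)
  have hD0 : D = 0 := eq_zero_of_eq_neg_self (F := F) D (by simpa using hSsim.2.2.2)
  have hBC : C = Bᵀ := hSt.2.1 ▸ (by simp)
  subst hA hD0 hBC
  have hB : IsUnit B := by
    obtain ⟨T, hT⟩ := hSu.exists_right_inv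
    rw [← fromBlocks_toBlocks T, fromBlocks_multiply, ← fromBlocks_one, fromBlocks_inj] at hT
    exact IsUnit.of_mul_eq_one T.toBlocks₂₁ (by simpa using hT.1)
  obtain ⟨B, rfl⟩ := hB
  have hR1 : (fromBlocks 1 0 0 ((B⁻¹ : GL (Fin n) F) : Matrix (Fin n) (Fin n) F) :
      Matrix (Fin n ⊕ Fin n) (Fin n ⊕ Fin n) F) *
      fromBlocks 1 0 0 (B : Matrix (Fin n) (Fin n) F) = 1 := by
    simp only [fromBlocks_multiply, B.inv_mul]; simp
  let R : GL (Fin n ⊕ Fin n) F :=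
    ⟨fromBlocks 1 0 0 ((B⁻¹ : GL (Fin n) F) : Matrix (Fin n) (Fin n) F),
      fromBlocks 1 0 0 (B : Matrix (Fin n) (Fin n) F), hR1, mul_eq_one_comm.mp hR1⟩
  have hRcomm : R * splitLevi n F (-1, 1) = splitLevi n F (-1, 1) * R := by
    refine Units.ext ?_
    rw [Units.val_mul, Units.val_mul, coe_splitLevi_neg_one]
    simp [R, fromBlocks_multiply, -coe_units_inv]
  refine ⟨Q * R, ?_, ?_⟩
  · have h1 : (B : Matrix (Fin n) (Fin n) F) *
        ((B⁻¹ : GL (Fin n) F) : Matrix (Fin n) (Fin n) F) = 1 := B.mul_inv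
    have h2 : ((B⁻¹ : GL (Fin n) F) : Matrix (Fin n) (Fin n) F)ᵀ *
        (B : Matrix (Fin n) (Fin n) F)ᵀ = 1 := by rw [← transpose_mul, h1, transpose_one]
    calc _ = (R : Matrix (Fin n ⊕ Fin n) (Fin n ⊕ Fin n) F)ᵀ * S * R := by
          rw [hS, Units.val_mul, transpose_mul]; simp only [Matrix.mul_assoc]
      _ = _ := by
          rw [hABCD]
          simp only [R, Jsplit, fromBlocks_transpose, fromBlocks_multiply]
          simp [-coe_units_inv, h1, h2]
  · rw [mul_assoc Q R, hRcomm, ← mul_assoc, ← hQ]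
    group

/-- The homomorphism from `Fˣ × GL(n, F)` to the similitude group of a split form `J`, obtained
from `splitLevi` through the change of basis `P`. -/
def leviHom {J : Matrix (Fin n ⊕ Fin n) (Fin n ⊕ Fin n) F} (P : GL (Fin n ⊕ Fin n) F)
    (hP : (P : Matrix (Fin n ⊕ Fin n) (Fin n ⊕ Fin n) F)ᵀ * J * P = Jsplit n F) :
    Fˣ × GL (Fin n) F →* ↥(similitudeGroup J) :=
  ((MulAut.conj P).toMonoidHom.comp (splitLevi n F)).codRestrict _ fun x =>
    ⟨x.1, sim_conj P _ _ hP (splitLevi_sim x)⟩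

theorem coe_leviHom {J : Matrix (Fin n ⊕ Fin n) (Fin n ⊕ Fin n) F} (P : GL (Fin n ⊕ Fin n) F)
    (hP : (P : Matrix (Fin n ⊕ Fin n) (Fin n ⊕ Fin n) F)ᵀ * J * P = Jsplit n F)
    (x : Fˣ × GL (Fin n) F) :
    (leviHom P hP x : GL (Fin n ⊕ Fin n) F) = P * splitLevi n F x * P⁻¹ :=
  rfl

theorem leviHom_injective (hn : 1 ≤ n) {J : Matrix (Fin n ⊕ Fin n) (Fin n ⊕ Fin n) F}
    (P : GL (Fin n ⊕ Fin n) F)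
    (hP : (P : Matrix (Fin n ⊕ Fin n) (Fin n ⊕ Fin n) F)ᵀ * J * P = Jsplit n F) :
    Function.Injective (leviHom P hP) := by
  intro x y hxy
  have h := congrArg Subtype.val hxy
  rw [coe_leviHom, coe_leviHom] at h
  exact splitLevi_injective hn (mul_left_cancel (mul_right_cancel h))

theorem range_leviHom [NeZero (2 : F)] {J : Matrix (Fin n ⊕ Fin n) (Fin n ⊕ Fin n) F}
    (P : GL (Fin n ⊕ Fin n) F)
    (hP : (P : Matrix (Fin n ⊕ Fin n) (Fin n ⊕ Fin n) F)ᵀ * J * P = Jsplit n F) :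
    (leviHom P hP).range = Subgroup.centralizer {leviHom P hP (-1, 1)} := by
  ext h
  rw [Subgroup.mem_centralizer_singleton_iff]
  constructor
  · rintro ⟨x, rfl⟩
    rw [← map_mul, ← map_mul]
    congr 1
    ext1 <;> simp
  · intro hcomm
    obtain ⟨h, c, hc⟩ := h
    have hcomm' := congrArg Subtype.val hcomm
    simp only [Subgroup.coe_mul, coe_leviHom] at hcomm'
    obtain ⟨x, hx⟩ := exists_splitLevi_eq (P⁻¹ * h * P) c
      (by simpa using sim_conj P⁻¹ h c (congr_inv P hP) hc) (by
        have := congrArg (fun z => P⁻¹ * z * P) hcomm'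
        simpa [Commute, SemiconjBy, mul_assoc] using this)
    refine ⟨x, Subtype.ext ?_⟩
    rw [coe_leviHom, hx]
    group

end SplitSimilitudes

theorem stmt_7 (n : ℕ) (hn : 1 ≤ n) (q : ℕ) (hq : ∃ p r : ℕ, p.Prime ∧ Odd p ∧ 0 < r ∧ q = p ^ r)
    (F : Type) [Field F] [Fintype F] [DecidableEq F] (hF : Fintype.card F = q)
    (J : Matrix (Fin n ⊕ Fin n) (Fin n ⊕ Fin n) F) (hJunit : IsUnit J) (hJsymm : Jᵀ = J)
    (hJsplit : IsSplit J) :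
    (∃ g : ↥(similitudeGroup J), g * g = 1 ∧
        (matOf g)ᵀ * J * matOf g = (-1 : F) • J) ∧
    (∀ g g' : ↥(similitudeGroup J),
        g * g = 1 → (matOf g)ᵀ * J * matOf g = (-1 : F) • J →
        g' * g' = 1 → (matOf g')ᵀ * J * matOf g' = (-1 : F) • J →
        IsConj g g') ∧
    (∀ g : ↥(similitudeGroup J),
        g * g = 1 → (matOf g)ᵀ * J * matOf g = (-1 : F) • J →
        Nonempty (↥(Subgroup.centralizer {g}) ≃* (Fˣ × GL (Fin n) F)) ∧
        Nat.card ↥(Subgroup.centralizer {g}) = (q - 1) * Nat.card (GL (Fin n) F)) := by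
  have h2 : NeZero (2 : F) := by
    refine ⟨fun h => ?_⟩
    obtain ⟨p, r, hp, hodd, hr, rfl⟩ := hq
    have : CharP F 2 := CharTwo.of_one_ne_zero_of_two_eq_zero one_ne_zero h
    have hdvd : 2 ∣ p ^ r := hF ▸ (CharP.cast_eq_zero_iff F 2 _).mp (FiniteField.cast_card_eq_zero F)
    exact (Nat.not_even_iff_odd.mpr (hodd.pow (n := r))) (even_iff_two_dvd.mpr hdvd)
  have key : ∀ g : ↥(similitudeGroup J), g * g = 1 → (matOf g)ᵀ * J * matOf g = (-1 : F) • J →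
      ∃ (P : GL (Fin n ⊕ Fin n) F)
        (hP : (P : Matrix (Fin n ⊕ Fin n) (Fin n ⊕ Fin n) F)ᵀ * J * P = Jsplit n F),
        g = leviHom P hP (-1, 1) := fun g hg hgJ => by
    obtain ⟨P, hP, hgP⟩ := exists_isometry_conj_splitLevi_neg_one (g : GL (Fin n ⊕ Fin n) F)
      hJunit hJsymm (congrArg Subtype.val hg) hgJ
    exact ⟨P, hP, Subtype.ext hgP⟩
  refine ⟨?_, ?_, ?_⟩
  · obtain ⟨P, hP⟩ := hJsplit
    refine ⟨leviHom P hP (-1, 1), ?_, ?_⟩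
    · rw [← map_mul, Prod.mk_mul_mk, neg_mul_neg, one_mul, mul_one]
      exact map_one _
    · exact sim_conj P _ _ hP (by simpa using splitLevi_sim ((-1 : Fˣ), (1 : GL (Fin n) F)))
  · intro g g' hg hgJ hg' hgJ'
    obtain ⟨P, hP, rfl⟩ := key g hg hgJ
    obtain ⟨P', hP', rfl⟩ := key g' hg' hgJ'
    refine isConj_iff.mpr ⟨⟨P' * P⁻¹, 1, ?_⟩, Subtype.ext ?_⟩
    · rw [Units.val_mul, transpose_mul, Units.val_one, one_smul]
      calc _ = ((P⁻¹ : GL (Fin n ⊕ Fin n) F) : Matrix (Fin n ⊕ Fin n) (Fin n ⊕ Fin n) F)ᵀ *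
            ((P' : Matrix (Fin n ⊕ Fin n) (Fin n ⊕ Fin n) F)ᵀ * J * P') *
            ((P⁻¹ : GL (Fin n ⊕ Fin n) F) : Matrix (Fin n ⊕ Fin n) (Fin n ⊕ Fin n) F) := by
            simp only [Matrix.mul_assoc]
        _ = J := by rw [hP', congr_inv P hP]
    · simp only [Subgroup.coe_mul, Subgroup.coe_inv, coe_leviHom]
      group
  · intro g hg hgJ
    obtain ⟨P, hP, rfl⟩ := key g hg hgJ
    have e : ↥(Subgroup.centralizer {leviHom P hP (-1, 1)}) ≃* (Fˣ × GL (Fin n) F) :=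
      (MulEquiv.subgroupCongr (range_leviHom P hP).symm).trans
        (MonoidHom.ofInjective (leviHom_injective hn P hP)).symm
    refine ⟨⟨e⟩, ?_⟩
    rw [Nat.card_congr e.toEquiv, Nat.card_prod, Nat.card_units, Nat.card_eq_fintype_card, hF]

end
end

section
/- Let q be a power of an odd prime, F_q a finite field with q elements, n ≥ 1, and let J ∈ M_{2n}(F_q) be an invertible symmetric matrix that is nonsplit, i.e. there is no invertible P with PᵀJP = [[0, I_n],[I_n, 0]]. Then there is no element g ∈ GO(J) with g² = I and μ(g) = −1. -/
open Matrix CategoryTheory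
open scoped Classical

noncomputable section

/-- An involution whose eigenspaces for `1` and `-1` have the same dimension is conjugate to
`diag(1, -1)`. -/
theorem exists_conj_of_involution {F : Type*} [Field F] (h2 : (2 : F) ≠ 0) {n : ℕ}
    {G : Matrix (Fin n ⊕ Fin n) (Fin n ⊕ Fin n) F} (hG : G * G = 1)
    (hrank : (G - 1).rank = (G + 1).rank) :
    ∃ P : GL (Fin n ⊕ Fin n) F,
      G * P.val = P.val * fromBlocks 1 0 0 (-1) := by
  have hGG (x : Fin n ⊕ Fin n → F) : G *ᵥ (G *ᵥ x) = x := by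
    rw [mulVec_mulVec, hG, one_mulVec]
  set U := LinearMap.ker (G - 1).mulVecLin with hU
  set W := LinearMap.ker (G + 1).mulVecLin with hW
  have memU {x} : x ∈ U ↔ G *ᵥ x = x := by
    simp [hU, sub_eq_zero]
  have memW {x} : x ∈ W ↔ G *ᵥ x = -x := by
    simp [hW, add_eq_zero_iff_eq_neg]
  have hcompl : IsCompl U W := by
    refine ⟨Submodule.disjoint_def.2 fun x hx hx' => ?_, codisjoint_iff.2 ?_⟩
    · have h : x = -x := (memU.1 hx).symm.trans (memW.1 hx')
      have h' : (2 : F) • x = 0 := by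
        rw [two_smul]; nth_rewrite 1 [h]; simp
      exact (smul_eq_zero.1 h').resolve_left h2
    · refine eq_top_iff.2 fun x _ => Submodule.mem_sup.2
        ⟨(2 : F)⁻¹ • (x + G *ᵥ x), memU.2 ?_, (2 : F)⁻¹ • (x - G *ᵥ x), memW.2 ?_, ?_⟩
      · rw [mulVec_smul, mulVec_add, hGG, add_comm]
      · rw [mulVec_smul, mulVec_sub, hGG, ← smul_neg, neg_sub]
      · rw [← smul_add, add_add_sub_cancel, ← two_smul F x, smul_smul, inv_mul_cancel₀ h2, one_smul]
  have hrU := LinearMap.finrank_range_add_finrank_ker (G - 1).mulVecLin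
  have hrW := LinearMap.finrank_range_add_finrank_ker (G + 1).mulVecLin
  have hsum := Submodule.finrank_add_eq_of_isCompl hcompl
  simp only [← Matrix.rank.eq_1, Module.finrank_fintype_fun_eq_card, Fintype.card_sum,
    Fintype.card_fin] at hrU hrW hsum
  rw [← hU] at hrU
  rw [← hW] at hrW
  let b := ((Module.finBasisOfFinrankEq F U (n := n) (by omega)).prod
    (Module.finBasisOfFinrankEq F W (n := n) (by omega))).map
      (Submodule.prodEquivOfIsCompl U W hcompl)
  let := b.invertibleToMatrix (Pi.basisFun F (Fin n ⊕ Fin n))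
  let := (Pi.basisFun F (Fin n ⊕ Fin n)).invertibleToMatrix b
  have hl (i : Fin n) : G *ᵥ b (Sum.inl i) = b (Sum.inl i) := memU.1 (by simp [b])
  have hr (i : Fin n) : G *ᵥ b (Sum.inr i) = -b (Sum.inr i) := memW.1 (by simp [b])
  refine ⟨unitOfInvertible ((Pi.basisFun F (Fin n ⊕ Fin n)).toMatrix b), ?_⟩
  have hD : (fromBlocks 1 0 0 (-1) : Matrix (Fin n ⊕ Fin n) (Fin n ⊕ Fin n) F) =
      diagonal (Sum.elim 1 (-1)) := by
    rw [← fromBlocks_diagonal]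
    congr 1
    ext i j
    simp [Matrix.one_apply, diagonal_apply, apply_ite]
  ext i j
  rw [hD, mul_diagonal]
  cases j with
  | inl j => simpa [Matrix.mul_apply, mulVec, dotProduct, Module.Basis.toMatrix_apply]
      using congrFun (hl j) i
  | inr j => simpa [Matrix.mul_apply, mulVec, dotProduct, Module.Basis.toMatrix_apply]
      using congrFun (hr j) i

/-- An involutive similitude of a nondegenerate form with multiplier `-1` has eigenspaces for `1`
and `-1` of the same dimension. -/
theorem rank_sub_one_eq_rank_add_one {N F : Type*} [Fintype N] [DecidableEq N] [Field F]
    {J G : Matrix N N F} (hJ : IsUnit J) (h : Gᵀ * J = -(J * G)) :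
    (G - 1).rank = (G + 1).rank := by
  have key : J * (G - 1) = (G + 1)ᵀ * -J := by
    rw [transpose_add, transpose_one, Matrix.add_mul, Matrix.mul_sub, Matrix.mul_neg, h]
    simp [sub_eq_add_neg]
  rw [← rank_mul_eq_right_of_isUnit_det J (G - 1) ((isUnit_iff_isUnit_det J).1 hJ), key,
    rank_mul_eq_left_of_isUnit_det (-J) _ ((isUnit_iff_isUnit_det _).1 hJ.neg), rank_transpose]

/-- A nondegenerate symmetric form of dimension `2 * n` with vanishing diagonal blocks is split. -/
theorem isSplit_fromBlocks {F : Type*} [Field F] {n : ℕ} {A : Matrix (Fin n) (Fin n) F}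
    (h : IsUnit (fromBlocks 0 A Aᵀ 0)) : IsSplit (fromBlocks 0 A Aᵀ 0) := by
  have hA : IsUnit A := by
    obtain ⟨N, hN⟩ := h.exists_right_inv
    rw [← fromBlocks_toBlocks N, fromBlocks_multiply, ← fromBlocks_one, fromBlocks_inj] at hN
    exact IsUnit.of_mul_eq_one _ (by simpa using hN.1)
  obtain ⟨u, rfl⟩ := hA
  refine ⟨⟨fromBlocks 1 0 0 (u⁻¹ : GL (Fin n) F), fromBlocks 1 0 0 u, ?_, ?_⟩, ?_⟩
  · simp only [fromBlocks_multiply]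
    simp
  · simp only [fromBlocks_multiply]
    simp
  · have ht : ((u⁻¹ : GL (Fin n) F) : Matrix (Fin n) (Fin n) F)ᵀ *
        (u : Matrix (Fin n) (Fin n) F)ᵀ = 1 := by
      rw [← transpose_mul, u.mul_inv, transpose_one]
    simp only [fromBlocks_transpose, fromBlocks_multiply, Jsplit]
    simp [ht, -coe_units_inv]

theorem IsSplit.of_congr {F : Type*} [Field F] {n : ℕ}
    {J : Matrix (Fin n ⊕ Fin n) (Fin n ⊕ Fin n) F} (P : GL (Fin n ⊕ Fin n) F)
    (h : IsSplit (P.valᵀ * J * P.val)) : IsSplit J := by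
  obtain ⟨Q, hQ⟩ := h
  refine ⟨P * Q, ?_⟩
  rw [← hQ, Units.val_mul, transpose_mul]
  simp only [Matrix.mul_assoc]

/-- A nondegenerate symmetric form over a field of characteristic not two is split as soon as it
has an involutive similitude with multiplier `-1`. -/
theorem isSplit_of_involutive_skew_similitude {F : Type*} [Field F] (h2 : (2 : F) ≠ 0) {n : ℕ}
    {J G : Matrix (Fin n ⊕ Fin n) (Fin n ⊕ Fin n) F} (hJ : IsUnit J) (hJsymm : Jᵀ = J)
    (hG : G * G = 1) (h : Gᵀ * J * G = -J) : IsSplit J := by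
  have hskew : Gᵀ * J = -(J * G) := by
    rw [← Matrix.neg_mul, ← h, Matrix.mul_assoc (Gᵀ * J), hG, Matrix.mul_one]
  obtain ⟨P, hP⟩ := exists_conj_of_involution h2 hG (rank_sub_one_eq_rank_add_one hJ hskew)
  refine IsSplit.of_congr P ?_
  set M := P.valᵀ * J * P.val with hM
  have hMunit : IsUnit M :=
    ((isUnit_transpose _).2 P.isUnit |>.mul hJ).mul P.isUnit
  have hMsymm : Mᵀ = M := by
    simp only [hM, transpose_mul, transpose_transpose, hJsymm, Matrix.mul_assoc]
  have hMD : (fromBlocks 1 0 0 (-1))ᵀ * M * fromBlocks 1 0 0 (-1) = -M := by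
    calc (fromBlocks 1 0 0 (-1))ᵀ * M * fromBlocks 1 0 0 (-1)
        = (P.val * fromBlocks 1 0 0 (-1))ᵀ * J *
            (P.val * fromBlocks 1 0 0 (-1)) := by
          simp only [hM, transpose_mul, Matrix.mul_assoc]
      _ = P.valᵀ * (Gᵀ * J * G) * P.val := by
          simp only [← hP, transpose_mul, Matrix.mul_assoc]
      _ = -M := by rw [h, Matrix.mul_neg, Matrix.neg_mul]
  have eq_zero {B : Matrix (Fin n) (Fin n) F} (hB : B = -B) : B = 0 := by
    have : (2 : F) • B = 0 := by
      rw [two_smul]; nth_rewrite 1 [hB]; simp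
    exact (smul_eq_zero.1 this).resolve_left h2
  rw [← fromBlocks_toBlocks M, fromBlocks_transpose, fromBlocks_inj] at hMsymm
  rw [← fromBlocks_toBlocks M, fromBlocks_transpose, fromBlocks_multiply, fromBlocks_multiply,
    fromBlocks_neg, fromBlocks_inj] at hMD
  have h11 : M.toBlocks₁₁ = 0 := eq_zero (by simpa using hMD.1)
  have h22 : M.toBlocks₂₂ = 0 := eq_zero (by simpa using hMD.2.2.2)
  have hblock : M = fromBlocks 0 M.toBlocks₁₂ M.toBlocks₁₂ᵀ 0 := by
    conv_lhs => rw [← fromBlocks_toBlocks M, h11, h22, ← hMsymm.2.2.1]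
  rw [hblock] at hMunit ⊢
  exact isSplit_fromBlocks hMunit

theorem stmt_8 (n : ℕ) (hn : 1 ≤ n) (q : ℕ) (hq : ∃ p r : ℕ, p.Prime ∧ Odd p ∧ 0 < r ∧ q = p ^ r)
    (F : Type) [Field F] [Fintype F] [DecidableEq F] (hF : Fintype.card F = q)
    (J : Matrix (Fin n ⊕ Fin n) (Fin n ⊕ Fin n) F) (hJunit : IsUnit J) (hJsymm : Jᵀ = J)
    (hJnonsplit : ¬ IsSplit J) :
    ¬ ∃ g : ↥(similitudeGroup J), g * g = 1 ∧
        (matOf g)ᵀ * J * matOf g = (-1 : F) • J := by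
  rintro ⟨g, hg, hsim⟩
  obtain ⟨p, r, hp, hodd, -, rfl⟩ := hq
  have h2 : (2 : F) ≠ 0 := by
    refine Ring.two_ne_zero fun hchar => ?_
    have := FiniteField.even_card_of_char_two hchar
    rw [hF] at this
    exact Nat.not_even_iff_odd.2 hodd.pow (Nat.even_iff.2 this)
  have hG : matOf g * matOf g = 1 :=
    congrArg (fun x : ↥(similitudeGroup J) => matOf x) hg
  exact hJnonsplit (isSplit_of_involutive_skew_similitude h2 hJunit hJsymm hG (by simpa using hsim))

end
end

section
/- For any real number q > 1 and any integers m ≥ 1 and 1 ≤ k ≤ m, the Gaussian binomial coefficient satisfies binom(m,k)_q ≤ q^{k(m−k) − m + 1} · (q+1)^{m−1}. -/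
open Matrix CategoryTheory
open scoped Classical

noncomputable section

theorem gbinom_add_left (k l : ℕ) (q : ℝ) :
    gbinom (k + l) k q = ∏ i ∈ Finset.Icc 1 k, (q ^ (l + i) - 1) / (q ^ i - 1) := by
  simp only [gbinom, Nat.add_sub_cancel_left]

theorem gbinom_zero_right (m : ℕ) (q : ℝ) : gbinom m 0 q = 1 := by
  simp [gbinom]

theorem pow_succ_sub_one_ne_zero {q : ℝ} (hq : 1 < q) (k : ℕ) : q ^ (k + 1) - 1 ≠ 0 :=
  (sub_pos.2 (one_lt_pow₀ hq k.succ_ne_zero)).ne'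

theorem gbinom_self {q : ℝ} (hq : 1 < q) (k : ℕ) : gbinom k k q = 1 := by
  refine Finset.prod_eq_one fun i hi => ?_
  obtain ⟨j, rfl⟩ := Nat.exists_eq_add_of_le' (Finset.mem_Icc.1 hi).1
  rw [Nat.sub_self, zero_add]
  exact div_self (pow_succ_sub_one_ne_zero hq j)

theorem gbinom_add_succ_left (k l : ℕ) (q : ℝ) :
    gbinom (k + 1 + l) (k + 1) q =
      gbinom (k + l) k q * ((q ^ (l + (k + 1)) - 1) / (q ^ (k + 1) - 1)) := by
  rw [gbinom_add_left, gbinom_add_left, Finset.prod_Icc_succ_top (Nat.le_add_left 1 k)]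

theorem gbinom_succ_mul {q : ℝ} (hq : 1 < q) (k l : ℕ) :
    gbinom (k + 1 + l) (k + 1) q * (q ^ (k + 1) - 1) =
      gbinom (k + (l + 1)) k q * (q ^ (l + 1) - 1) := by
  induction k with
  | zero =>
    rw [gbinom_add_succ_left, mul_assoc, div_mul_cancel₀ _ (pow_succ_sub_one_ne_zero hq 0)]
    simp only [gbinom_zero_right, zero_add]
  | succ k ih =>
    have h₁ := pow_succ_sub_one_ne_zero hq k
    have h₂ := pow_succ_sub_one_ne_zero hq (k + 1)
    rw [gbinom_add_succ_left (k + 1) l, gbinom_add_succ_left k (l + 1), mul_assoc,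
      div_mul_cancel₀ _ h₂, eq_div_of_mul_eq h₁ ih, show l + (k + 1 + 1) = l + 1 + (k + 1) by ring]
    ring

/-- The `q`-Pascal recurrence. -/
theorem gbinom_pascal {q : ℝ} (hq : 1 < q) (k l : ℕ) :
    gbinom (k + 1 + (l + 1)) (k + 1) q =
      q ^ (k + 1) * gbinom (k + 1 + l) (k + 1) q + gbinom (k + (l + 1)) k q := by
  have h := pow_succ_sub_one_ne_zero hq k
  rw [gbinom_add_succ_left k (l + 1), eq_div_of_mul_eq h (gbinom_succ_mul hq k l)]
  field_simp
  ring

theorem gbinom_mul_pow_le {q : ℝ} (hq : 1 < q) (n k l : ℕ) (h : k + l = n + 1) :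
    gbinom (k + l) k q * q ^ n ≤ q ^ (k * l) * (q + 1) ^ n := by
  have hq₀ : 0 ≤ q := by linarith
  have hle (n : ℕ) : q ^ n ≤ (q + 1) ^ n := pow_le_pow_left₀ hq₀ (by linarith) n
  induction n generalizing k l with
  | zero =>
    rcases (by omega : k = 0 ∨ l = 0) with rfl | rfl
    · simp [gbinom_zero_right]
    · simp [gbinom_self hq]
  | succ n ih =>
    rcases k with _ | k
    · simpa [gbinom_zero_right] using hle (n + 1)
    rcases l with _ | l
    · simpa [gbinom_self hq] using hle (n + 1)
    have h₁ := ih (k + 1) l (by omega)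
    have h₂ := ih k (l + 1) (by omega)
    have h₃ : q ^ (k * l + k + 1) ≤ q ^ (k * l + k + l + 1) :=
      pow_le_pow_right₀ hq.le (by omega)
    calc gbinom (k + 1 + (l + 1)) (k + 1) q * q ^ (n + 1)
        = q ^ (k + 1 + 1) * (gbinom (k + 1 + l) (k + 1) q * q ^ n) +
            q * (gbinom (k + (l + 1)) k q * q ^ n) := by
          rw [gbinom_pascal hq]; ring
      _ ≤ q ^ (k + 1 + 1) * (q ^ ((k + 1) * l) * (q + 1) ^ n) +
            q * (q ^ (k * (l + 1)) * (q + 1) ^ n) := by gcongr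
      _ = (q ^ (k * l + k + l + 1) * q + q ^ (k * l + k + 1)) * (q + 1) ^ n := by ring
      _ ≤ (q ^ (k * l + k + l + 1) * q + q ^ (k * l + k + l + 1)) * (q + 1) ^ n := by gcongr
      _ = q ^ ((k + 1) * (l + 1)) * (q + 1) ^ (n + 1) := by ring

theorem stmt_15 (q : ℝ) (hq : 1 < q) (m k : ℕ) (hm : 1 ≤ m) (hk : 1 ≤ k)
    (hkm : k ≤ m) :
    gbinom m k q ≤ q ^ (((k * (m - k) : ℕ) : ℤ) - (m : ℤ) + 1) * (q + 1) ^ (m - 1) := by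
  have hq₀ : 0 < q := by linarith
  have h := gbinom_mul_pow_le hq (m - 1) k (m - k) (by omega)
  rw [Nat.add_sub_cancel' hkm] at h
  have he : (((k * (m - k) : ℕ) : ℤ) - (m : ℤ) + 1) =
      ((k * (m - k) : ℕ) : ℤ) - ((m - 1 : ℕ) : ℤ) := by
    rw [Nat.cast_sub hm, Nat.cast_one]
    ring
  rw [he, zpow_sub₀ hq₀.ne', zpow_natCast, zpow_natCast, div_mul_eq_mul_div,
    le_div_iff₀ (pow_pos hq₀ _)]
  exact h

end
end

section
/- For any integer m ≥ 0 and any real number q > 1, Σ_{k=0}^{m} q^{2k(m−k+1)} · binom(m,k)_{q²} ≤ (q+1)^{m² + m}. -/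
open Matrix CategoryTheory
open scoped Classical

noncomputable section

theorem pow_add_sub_one_le {x : ℝ} (hx : 1 ≤ x) (b : ℕ) {i : ℕ} (hi : 1 ≤ i) :
    x ^ (b + i) - 1 ≤ (1 + x) ^ b * (x ^ i - 1) := by
  have hxi : x ≤ x ^ i := le_self_pow₀ hx (by omega)
  induction b with
  | zero => simp
  | succ b ih =>
    have h1 : 1 ≤ (1 + x) ^ b := one_le_pow₀ (by linarith)
    have h2 : x * (x ^ (b + i) - 1) ≤ x * ((1 + x) ^ b * (x ^ i - 1)) :=
      mul_le_mul_of_nonneg_left ih (by linarith)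
    have h3 : x ^ i - 1 ≤ (1 + x) ^ b * (x ^ i - 1) :=
      le_mul_of_one_le_left (by linarith) h1
    calc x ^ (b + 1 + i) - 1 = x * (x ^ (b + i) - 1) + (x - 1) := by ring
      _ ≤ x * ((1 + x) ^ b * (x ^ i - 1)) + (1 + x) ^ b * (x ^ i - 1) := by linarith
      _ = (1 + x) ^ (b + 1) * (x ^ i - 1) := by ring

theorem gbinom_le_pow {x : ℝ} (hx : 1 < x) (m k : ℕ) :
    gbinom m k x ≤ (1 + x) ^ (k * (m - k)) := by
  have h : gbinom m k x ≤ ∏ _i ∈ Finset.Icc 1 k, (1 + x) ^ (m - k) := by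
    refine Finset.prod_le_prod (fun i hi => ?_) (fun i hi => ?_)
    · exact div_nonneg (sub_nonneg.2 (one_le_pow₀ hx.le)) (sub_nonneg.2 (one_le_pow₀ hx.le))
    · have hi1 : 1 ≤ i := (Finset.mem_Icc.1 hi).1
      rw [div_le_iff₀ (sub_pos.2 (one_lt_pow₀ hx (by omega)))]
      exact pow_add_sub_one_le hx.le _ hi1
  refine h.trans_eq ?_
  rw [Finset.prod_const, Nat.card_Icc, Nat.add_sub_cancel, ← pow_mul, mul_comm]

/-- The summand of index `k = j + 1`, with `m = j + a + 1`. -/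
theorem summand_le {q : ℝ} (hq : 1 < q) (j a : ℕ) :
    q ^ (2 * (j + 1) * (a + 1)) * gbinom (j + a + 1) (j + 1) (q ^ 2)
      ≤ q ^ (2 * (j + a + 1)) * (q + 1) ^ (4 * j * a + 2 * a) := by
  have hg := gbinom_le_pow (one_lt_pow₀ hq two_ne_zero) (j + a + 1) (j + 1)
  rw [show j + a + 1 - (j + 1) = a by omega] at hg
  have h1 : (1 + q ^ 2) ^ ((j + 1) * a) ≤ ((q + 1) ^ 2) ^ ((j + 1) * a) :=
    pow_le_pow_left₀ (by positivity) (by nlinarith) _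
  have h2 : q ^ (2 * j * a) ≤ (q + 1) ^ (2 * j * a) :=
    pow_le_pow_left₀ (by linarith) (by linarith) _
  calc q ^ (2 * (j + 1) * (a + 1)) * gbinom (j + a + 1) (j + 1) (q ^ 2)
      ≤ q ^ (2 * (j + 1) * (a + 1)) * ((q + 1) ^ 2) ^ ((j + 1) * a) := by
        gcongr
        exact hg.trans h1
    _ = q ^ (2 * (j + a + 1)) * (q ^ (2 * j * a) * (q + 1) ^ (2 * (j + 1) * a)) := by
        rw [← pow_mul, ← mul_assoc (q ^ (2 * (j + a + 1))), ← pow_add]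
        congr 2 <;> ring
    _ ≤ q ^ (2 * (j + a + 1)) * ((q + 1) ^ (2 * j * a) * (q + 1) ^ (2 * (j + 1) * a)) := by
        gcongr
    _ = q ^ (2 * (j + a + 1)) * (q + 1) ^ (4 * j * a + 2 * a) := by
        rw [← pow_add]
        congr 2
        ring

theorem pow_add_mul_pow_le {q : ℝ} (hq : 1 < q) (n : ℕ) :
    q ^ (2 * n + 2) + (n + 1) * q ^ (2 * n) ≤ (q + 1) ^ (2 * n + 2) := by
  induction n with
  | zero => norm_num; nlinarith
  | succ n ih =>
    have hp : 0 < q ^ (2 * n) := by positivity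
    push_cast
    calc q ^ (2 * (n + 1) + 2) + ((n : ℝ) + 1 + 1) * q ^ (2 * (n + 1))
        ≤ (q ^ (2 * n + 2) + (n + 1) * q ^ (2 * n)) * (q ^ 2 + 1) := by
          have : 0 ≤ ((n : ℝ) + 1) * q ^ (2 * n) := by positivity
          ring_nf at this ⊢
          linarith
      _ ≤ (q + 1) ^ (2 * n + 2) * (q + 1) ^ 2 := by
          gcongr
          nlinarith
      _ = (q + 1) ^ (2 * (n + 1) + 2) := by ring

theorem stmt_17 (m : ℕ) (q : ℝ) (hq : 1 < q) :
    ∑ k ∈ Finset.range (m + 1), q ^ (2 * k * (m - k + 1)) * gbinom m k (q ^ 2)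
      ≤ (q + 1) ^ (m ^ 2 + m) := by
  obtain _ | n := m
  · simp [gbinom]
  have hP : 1 ≤ (q + 1) ^ (n ^ 2 + n) := one_le_pow₀ (by linarith)
  obtain ⟨k₀, hk₀⟩ : ∃ k₀, k₀ = n / 2 + 1 := ⟨_, rfl⟩
  have hmem : k₀ ∈ Finset.range (n + 1 + 1) := Finset.mem_range.2 (by omega)
  have hmain : q ^ (2 * k₀ * (n + 1 - k₀ + 1)) * gbinom (n + 1) k₀ (q ^ 2)
      ≤ q ^ (2 * n + 2) * (q + 1) ^ (n ^ 2 + n) := by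
    obtain ⟨j, a, hj, ha⟩ : ∃ j a, k₀ = j + 1 ∧ n = j + a :=
      ⟨n / 2, n - n / 2, by omega, by omega⟩
    rw [hj, ha, show j + a + 1 - (j + 1) + 1 = a + 1 by omega]
    refine (summand_le hq j a).trans ?_
    rw [show 2 * (j + a + 1) = 2 * (j + a) + 2 by ring]
    have : 4 * j * a + 2 * a ≤ (j + a) ^ 2 + (j + a) := by
      obtain rfl | rfl : a = j ∨ a = j + 1 := by omega
      all_goals nlinarith
    gcongr
    linarith
  have hother : ∀ k ∈ (Finset.range (n + 1 + 1)).erase k₀,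
      q ^ (2 * k * (n + 1 - k + 1)) * gbinom (n + 1) k (q ^ 2)
        ≤ q ^ (2 * n) * (q + 1) ^ (n ^ 2 + n) := by
    intro k hk
    rw [Finset.mem_erase, Finset.mem_range] at hk
    obtain _ | j := k
    · simpa [gbinom] using one_le_mul_of_one_le_of_one_le (one_le_pow₀ hq.le) hP
    obtain ⟨a, rfl⟩ : ∃ a, n = j + a := ⟨n - j, by omega⟩
    rw [show j + a + 1 - (j + 1) + 1 = a + 1 by omega]
    refine (summand_le hq j a).trans ?_
    have hexp : 4 * j * a + 2 * a + 2 ≤ (j + a) ^ 2 + (j + a) := by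
      obtain ⟨d, rfl⟩ | ⟨d, rfl⟩ : (∃ d, j = a + 1 + d) ∨ ∃ d, a = j + 2 + d := by
        rcases Nat.lt_or_ge a j with h | h
        · exact Or.inl ⟨j - a - 1, by omega⟩
        · exact Or.inr ⟨a - j - 2, by omega⟩
      all_goals nlinarith
    calc q ^ (2 * (j + a + 1)) * (q + 1) ^ (4 * j * a + 2 * a)
        = q ^ (2 * (j + a)) * (q ^ 2 * (q + 1) ^ (4 * j * a + 2 * a)) := by ring
      _ ≤ q ^ (2 * (j + a)) * ((q + 1) ^ 2 * (q + 1) ^ (4 * j * a + 2 * a)) := by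
          gcongr
          linarith
      _ = q ^ (2 * (j + a)) * (q + 1) ^ (4 * j * a + 2 * a + 2) := by ring
      _ ≤ q ^ (2 * (j + a)) * (q + 1) ^ ((j + a) ^ 2 + (j + a)) := by
          gcongr
          linarith
  have hsum := Finset.sum_le_card_nsmul _ _ _ hother
  rw [Finset.card_erase_of_mem hmem, Finset.card_range, Nat.add_sub_cancel, nsmul_eq_mul] at hsum
  push_cast at hsum
  rw [← Finset.add_sum_erase _ _ hmem]
  calc _ ≤ q ^ (2 * n + 2) * (q + 1) ^ (n ^ 2 + n)
        + (n + 1) * (q ^ (2 * n) * (q + 1) ^ (n ^ 2 + n)) := add_le_add hmain hsum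
    _ = (q ^ (2 * n + 2) + (n + 1) * q ^ (2 * n)) * (q + 1) ^ (n ^ 2 + n) := by ring
    _ ≤ (q + 1) ^ (2 * n + 2) * (q + 1) ^ (n ^ 2 + n) := by
        gcongr
        exact pow_add_mul_pow_le hq n
    _ = (q + 1) ^ ((n + 1) ^ 2 + (n + 1)) := by
        rw [← pow_add]
        congr 1
        ring

end
end
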